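/- Let k be an algebraically closed field of characteristic p > 0, let G be a normal subgroup of a finite group G̃, and let M be a finitely generated kG-module such that xM ≅ M as kG-modules for every x ∈ G̃. If f : kG → M' is a left (add M)-approximation of kG with M' ∈ add M, then Ind_G^{G̃} f : kG̃ → Ind_G^{G̃} M' is a left (add Ind_G^{G̃} M)-approximation of kG̃. -/

import Mathlib

/-!
Common definitions: τ-tilting theory over a ring, blocks of group algebras,
conjugate modules and induced modules.

Since group algebras (and their blocks) are symmetric algebras, the
Auslander–Reiten translate is `τ = Ω²` computed via (minimal) projective covers;
τ-rigidity is formulated accordingly.  Support τ-tilting modules are formulated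
via support τ-tilting pairs: `M` is support τ-tilting iff `M` is τ-rigid and
there is a projective module `P` with `Hom(P, M) = 0` and `|M| + |P| = |Λ|`
(the number of simple modules), which is the standard equivalent
characterisation (Adachi–Iyama–Reiten, Prop. 2.3; Remark 2.2 of the paper).
-/

universe u

section GeneralDefs

variable (A : Type u) [Ring A]

/-- A module is indecomposable if it is nontrivial and has no nontrivial
direct sum decomposition. -/
def IsIndecModule (X : Type u) [AddCommGroup X] [Module A X] : Prop :=
  Nontrivial X ∧ ∀ U V : Submodule A X, IsCompl U V → U = ⊥ ∨ V = ⊥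

/-- `|M|`: the number of isomorphism classes of indecomposable direct summands
of `M`. -/
noncomputable def numIndec (M : Type u) [AddCommGroup M] [Module A M] : ℕ :=
  Nat.card (Quot fun
    (L L' : {L : Submodule A M // (∃ L'', IsCompl L L'') ∧ IsIndecModule A L}) =>
      Nonempty (L.1 ≃ₗ[A] L'.1))

/-- `|A|`: the number of isomorphism classes of simple `A`-modules. -/
noncomputable def numSimples : ℕ :=
  Nat.card (Quot fun (X Y : {X : ModuleCat.{u} A // IsSimpleModule A X}) =>
    Nonempty ((X.1 : Type u) ≃ₗ[A] (Y.1 : Type u)))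

/-- The number of isomorphism classes of simple `A`-modules lying in the block
with block idempotent `b` (i.e. on which `b` acts as the identity). -/
noncomputable def numSimplesIn (b : A) : ℕ :=
  Nat.card (Quot fun
    (X Y : {X : ModuleCat.{u} A //
        IsSimpleModule A X ∧ ∀ v : (X : Type u), b • v = v}) =>
      Nonempty ((X.1 : Type u) ≃ₗ[A] (Y.1 : Type u)))

/-- `π : P → M` is a projective cover: `P` is projective, `π` is surjective and
`ker π` is superfluous (i.e. `π` is an essential epimorphism). -/
def IsProjCover {P M : Type u} [AddCommGroup P] [Module A P]
    [AddCommGroup M] [Module A M] (π : P →ₗ[A] M) : Prop :=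
  Module.Projective A P ∧ Function.Surjective π ∧
    ∀ N : Submodule A P, N ⊔ LinearMap.ker π = ⊤ → N = ⊤

/-- `M` is τ-rigid: `Hom(M, τ M) = 0`, where for the symmetric algebras
considered here `τ M = Ω² M` is computed from minimal projective presentations:
for (any) projective cover `π₀ : P₀ → M` and projective cover
`π₁ : P₁ → ker π₀`, one has `τ M = ker π₁`. -/
def IsTauRigid (M : Type u) [AddCommGroup M] [Module A M] : Prop :=
  ∀ (P₀ : Type u) [AddCommGroup P₀] [Module A P₀] (π₀ : P₀ →ₗ[A] M),
    IsProjCover A π₀ →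
    ∀ (P₁ : Type u) [AddCommGroup P₁] [Module A P₁]
      (π₁ : P₁ →ₗ[A] ↥(LinearMap.ker π₀)),
      IsProjCover A π₁ →
      ∀ g : M →ₗ[A] ↥(LinearMap.ker π₁), g = 0

/-- `M` is a support τ-tilting `A`-module (via support τ-tilting pairs):
`M` is τ-rigid and there is a (finitely generated) projective `A`-module `P`
with `Hom_A(P, M) = 0` and `|M| + |P| = |A|`. -/
def IsSupportTauTilting (M : Type u) [AddCommGroup M] [Module A M] : Prop :=
  IsTauRigid A M ∧
  ∃ P : ModuleCat.{u} A, Module.Projective A P ∧ Module.Finite A P ∧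
    (∀ f : (P : Type u) →ₗ[A] M, f = 0) ∧
    numIndec A M + numIndec A (P : Type u) = numSimples A

/-- `b` is a block idempotent: a primitive central idempotent of `A`.
The corresponding block is `B = A * b`. -/
def IsBlockIdem (b : A) : Prop :=
  b ≠ 0 ∧ b * b = b ∧ (∀ r : A, b * r = r * b) ∧
  ∀ c : A, c * c = c → (∀ r : A, c * r = r * c) → b * c = c → c = 0 ∨ c = b

/-- `M` is a support τ-tilting module over the block `B` with block idempotent
`b`: `M` lies in `B`, is τ-rigid (over `B`, equivalently over `A`) and there is
a projective module `P` lying in `B` with `Hom(P, M) = 0` and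
`|M| + |P| = |B|`. -/
def IsSupportTauTiltingBlock (b : A) (M : Type u) [AddCommGroup M]
    [Module A M] : Prop :=
  (∀ m : M, b • m = m) ∧ IsTauRigid A M ∧
  ∃ P : ModuleCat.{u} A, Module.Projective A P ∧ Module.Finite A P ∧
    (∀ v : (P : Type u), b • v = v) ∧
    (∀ f : (P : Type u) →ₗ[A] M, f = 0) ∧
    numIndec A M + numIndec A (P : Type u) = numSimplesIn A b

/-- The partial order on support τ-tilting modules: `M ≥ M'` iff there are
`r > 0` and an epimorphism `M^{⊕ r} ↠ M'`. -/
def stGE (M M' : Type u) [AddCommGroup M] [Module A M]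
    [AddCommGroup M'] [Module A M'] : Prop :=
  ∃ r : ℕ, 0 < r ∧ ∃ φ : (Fin r → M) →ₗ[A] M', Function.Surjective φ

/-- `X ∈ add M`: `X` is a direct summand of a finite direct sum of copies
of `M`. -/
def InAdd (M X : Type u) [AddCommGroup M] [Module A M]
    [AddCommGroup X] [Module A X] : Prop :=
  ∃ (n : ℕ) (i : X →ₗ[A] (Fin n → M)) (p : (Fin n → M) →ₗ[A] X),
    p.comp i = LinearMap.id

/-- For a central idempotent `b` of `A`, the direct summand `b • N` of an
`A`-module `N`, realised as the submodule of elements on which `b` acts as the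
identity. -/
def blockComponent (b : A) (hb : ∀ r : A, b * r = r * b)
    (N : Type u) [AddCommGroup N] [Module A N] : Submodule A N where
  carrier := {n | b • n = n}
  add_mem' := by
    intro a c ha hc
    simp only [Set.mem_setOf_eq, smul_add] at *
    rw [ha, hc]
  zero_mem' := by simp
  smul_mem' := by
    intro r n hn
    simp only [Set.mem_setOf_eq] at *
    rw [← mul_smul, hb, mul_smul, hn]

end GeneralDefs

section InducedDefs

/-- `(N, j)` is the module induced from `M` along the ring homomorphism
`ι : R →+* S`, i.e. `N ≅ S ⊗_R M`, characterised by the universal property of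
extension of scalars: `j : M → N` is `R`-linear (with `R` acting on `N` via
`ι`) and every `R`-linear map from `M` to (the restriction of) an `S`-module
`X` factors uniquely through an `S`-linear map `N → X`. -/
def IsInducedMod {R S : Type u} [Ring R] [Ring S] (ι : R →+* S)
    (M : Type u) [AddCommGroup M] [Module R M]
    (N : Type u) [AddCommGroup N] [Module S N] (j : M →+ N) : Prop :=
  (∀ (r : R) (m : M), j (r • m) = ι r • j m) ∧
  ∀ (X : Type u) [AddCommGroup X] [Module S X] (f : M →+ X),
    (∀ (r : R) (m : M), f (r • m) = ι r • f m) →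
    ∃! g : N →ₗ[S] X, ∀ m : M, g (j m) = f m

end InducedDefs

section GroupDefs

variable (k : Type u) [Field k] (Gt : Type u) [Group Gt] (G : Subgroup Gt)
  [G.Normal]

/-- The ring automorphism of `kG` induced by conjugation by `x ∈ G̃` on the
normal subgroup `G`. -/
noncomputable def conjRingHom (x : Gt) :
    MonoidAlgebra k ↥G →+* MonoidAlgebra k ↥G :=
  MonoidAlgebra.mapDomainRingHom k (MulAut.conjNormal (H := G) x)

/-- The ring homomorphism `kG →+* kG̃` induced by the inclusion `G ≤ G̃`. -/
noncomputable def inclRingHom : MonoidAlgebra k ↥G →+* MonoidAlgebra k Gt :=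
  MonoidAlgebra.mapDomainRingHom k G.subtype

/-- `x M ≅ M`: the conjugate module `x M` (with `g` acting as `x⁻¹ g x` does
on `M`) is isomorphic to `M`; equivalently, there is an additive automorphism
of `M` which is semilinear for the conjugation automorphism of `kG`. -/
def IsConjStable (x : Gt) (M : Type u) [AddCommGroup M]
    [Module (MonoidAlgebra k ↥G) M] : Prop :=
  ∃ φ : M ≃+ M, ∀ (r : MonoidAlgebra k ↥G) (m : M),
    φ (conjRingHom k Gt G x r • m) = r • φ m

end GroupDefs

section Add

variable {A : Type u} [Ring A] {M N X : Type u} [AddCommGroup M] [Module A M]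
  [AddCommGroup N] [Module A N] [AddCommGroup X] [Module A X]

theorem InAdd.of_fintype {ι : Type*} [Fintype ι] (i : X →ₗ[A] (ι → M)) (p : (ι → M) →ₗ[A] X)
    (h : p.comp i = LinearMap.id) : InAdd A M X := by
  let e := LinearEquiv.funCongrLeft A M (Fintype.equivFin ι)
  refine ⟨Fintype.card ι, e.symm.toLinearMap.comp i, p.comp e.toLinearMap, ?_⟩
  ext x
  simpa using LinearMap.congr_fun h x

theorem InAdd.trans (hN : InAdd A M N) (hX : InAdd A N X) : InAdd A M X := by
  obtain ⟨m, i, p, hpi⟩ := hN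
  obtain ⟨n, i', p', hpi'⟩ := hX
  refine InAdd.of_fintype (ι := Fin n × Fin m)
    (LinearMap.pi fun a => (LinearMap.proj a.2).comp (i.comp ((LinearMap.proj a.1).comp i')))
    (p'.comp (LinearMap.pi fun a => p.comp (LinearMap.funLeft A M (Prod.mk a)))) ?_
  ext x
  have key : (fun a => p fun b => i (i' x a) b) = i' x :=
    funext fun a => LinearMap.congr_fun hpi (i' x a)
  have := LinearMap.congr_fun hpi' x
  rw [LinearMap.comp_apply, ← key] at this
  exact this

theorem InAdd.restrictScalars {B : Type u} [Ring B] [Module B N] [Module B X] (ι : B →+* A)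
    (hBN : ∀ (b : B) (n : N), b • n = ι b • n) (hBX : ∀ (b : B) (x : X), b • x = ι b • x)
    (h : InAdd A N X) : InAdd B N X := by
  obtain ⟨n, i, p, hpi⟩ := h
  refine ⟨n, { i with map_smul' := fun b x => ?_ }, { p with map_smul' := fun b v => ?_ }, ?_⟩
  · change i (b • x) = b • i x
    ext a
    rw [hBX, map_smul, Pi.smul_apply, Pi.smul_apply, hBN]
  · change p (b • v) = b • p v
    rw [hBX, ← map_smul]
    congr 1
    ext a
    exact hBN b (v a)
  · ext x
    exact LinearMap.congr_fun hpi x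

end Add

section Coinduced

variable {R S : Type u} [Ring R] [Ring S] (ι : R →+* S) (M : Type u) [AddCommGroup M] [Module R M]

/-- The module coinduced from `M` along `ι`: additive maps `S → M` commuting with left
multiplication by `R`. -/
def coinduced : AddSubgroup (S →+ M) where
  carrier := {F | ∀ (r : R) (s : S), F (ι r * s) = r • F s}
  add_mem' := by
    intro F F' hF hF' r s
    simp [hF r s, hF' r s]
  zero_mem' := by simp
  neg_mem' := by
    intro F hF r s
    simp [hF r s]

instance coinducedModule : Module S (coinduced ι M) where
  smul s F := ⟨F.1.comp (AddMonoidHom.mulRight s), fun r t => by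
    simpa [mul_assoc] using F.2 r (t * s)⟩
  one_smul F := Subtype.ext <| AddMonoidHom.ext fun t => congrArg F.1 (mul_one t)
  mul_smul s s' F := Subtype.ext <| AddMonoidHom.ext fun t =>
    congrArg F.1 (mul_assoc t s s').symm
  smul_zero s := rfl
  smul_add s F F' := rfl
  add_smul s s' F := Subtype.ext <| AddMonoidHom.ext fun t =>
    (congrArg F.1 (mul_add t s s')).trans (map_add F.1 _ _)
  zero_smul F := Subtype.ext <| AddMonoidHom.ext fun t =>
    (congrArg F.1 (mul_zero t)).trans (map_zero F.1)

theorem coinduced_smul_apply (s t : S) (F : coinduced ι M) : (s • F).1 t = F.1 (t * s) := rfl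

/-- An `R`-bilinear retraction `π : S → R` of `ι` gives a map from the induced to the coinduced
module. -/
theorem IsInducedMod.exists_toCoinduced {ι : R →+* S} {M : Type u} [AddCommGroup M] [Module R M]
    {N : Type u} [AddCommGroup N] [Module S N] {j : M →+ N} (hN : IsInducedMod ι M N j)
    (π : S →+ R) (hl : ∀ r s, π (ι r * s) = r * π s) (hr : ∀ s r, π (s * ι r) = π s * r) :
    ∃ α : N →ₗ[S] coinduced ι M, ∀ m s, (α (j m)).1 s = π s • m := by
  let F : M →+ coinduced ι M :=
    { toFun := fun m => ⟨((AddMonoidHom.flip (smulAddHom R M)) m).comp π, fun r s => by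
        simp [hl, mul_smul]⟩
      map_zero' := by ext; simp
      map_add' := fun m m' => by ext; simp }
  obtain ⟨α, hα, -⟩ := hN.2 (coinduced ι M) F fun r m => by
    ext s
    change π s • r • m = π (s * ι r) • m
    rw [hr, mul_smul]
  exact ⟨α, fun m s => by rw [hα]; rfl⟩

end Coinduced

section GroupAlgebra

variable (k : Type u) [Field k] (Gt : Type u) [Group Gt] (G : Subgroup Gt)

open Classical in
/-- Restriction of coefficients `kG̃ → kG`. -/
noncomputable def restrictCoeff : MonoidAlgebra k Gt →+ MonoidAlgebra k ↥G :=
  MonoidAlgebra.liftNC (algebraMap k (MonoidAlgebra k ↥G) : k →+ MonoidAlgebra k ↥G)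
    fun x => if h : x ∈ G then MonoidAlgebra.single ⟨x, h⟩ 1 else 0

variable {Gt} in
theorem restrictCoeff_single_mem (x : Gt) (a : k) (hx : x ∈ G) :
    restrictCoeff k Gt G (MonoidAlgebra.single x a) = MonoidAlgebra.single ⟨x, hx⟩ a := by
  simp [restrictCoeff, hx, MonoidAlgebra.single_mul_single]

variable {Gt} in
theorem restrictCoeff_single_notMem (x : Gt) (a : k) (hx : x ∉ G) :
    restrictCoeff k Gt G (MonoidAlgebra.single x a) = 0 := by
  simp [restrictCoeff, hx]

theorem inclRingHom_single [G.Normal] (g : G) (a : k) :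
    inclRingHom k Gt G (MonoidAlgebra.single g a) = MonoidAlgebra.single (g : Gt) a := by
  simp [inclRingHom]

theorem restrictCoeff_incl_mul [G.Normal] (r : MonoidAlgebra k ↥G) (s : MonoidAlgebra k Gt) :
    restrictCoeff k Gt G (inclRingHom k Gt G r * s) = r * restrictCoeff k Gt G s := by
  induction r using MonoidAlgebra.induction_linear with
  | zero => simp
  | add r r' hr hr' => simp [add_mul, hr, hr']
  | single g a =>
    induction s using MonoidAlgebra.induction_linear with
    | zero => simp
    | add s s' hs hs' => simp [mul_add, hs, hs']
    | single x b =>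
      rw [inclRingHom_single, MonoidAlgebra.single_mul_single]
      by_cases hx : x ∈ G
      · rw [restrictCoeff_single_mem k G x b hx,
          restrictCoeff_single_mem k G _ _ (G.mul_mem g.2 hx), MonoidAlgebra.single_mul_single]
        rfl
      · rw [restrictCoeff_single_notMem k G x b hx, restrictCoeff_single_notMem k G, mul_zero]
        rwa [G.mul_mem_cancel_left g.2]

theorem restrictCoeff_mul_incl [G.Normal] (s : MonoidAlgebra k Gt) (r : MonoidAlgebra k ↥G) :
    restrictCoeff k Gt G (s * inclRingHom k Gt G r) = restrictCoeff k Gt G s * r := by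
  induction r using MonoidAlgebra.induction_linear with
  | zero => simp
  | add r r' hr hr' => simp [mul_add, hr, hr']
  | single g a =>
    induction s using MonoidAlgebra.induction_linear with
    | zero => simp
    | add s s' hs hs' => simp [add_mul, hs, hs']
    | single x b =>
      rw [inclRingHom_single, MonoidAlgebra.single_mul_single]
      by_cases hx : x ∈ G
      · rw [restrictCoeff_single_mem k G x b hx,
          restrictCoeff_single_mem k G _ _ (G.mul_mem hx g.2), MonoidAlgebra.single_mul_single]
        rfl
      · rw [restrictCoeff_single_notMem k G x b hx, restrictCoeff_single_notMem k G, zero_mul]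
        rwa [G.mul_mem_cancel_right g.2]

variable {Gt} in
theorem of_mul_inclRingHom [G.Normal] (x : Gt) (r : MonoidAlgebra k ↥G) :
    MonoidAlgebra.of k Gt x * inclRingHom k Gt G r =
      inclRingHom k Gt G (conjRingHom k Gt G x r) * MonoidAlgebra.of k Gt x := by
  induction r using MonoidAlgebra.induction_linear with
  | zero => simp
  | add r r' hr hr' => simp only [map_add, mul_add, add_mul, hr, hr']
  | single g a => simp [conjRingHom, inclRingHom, MonoidAlgebra.single_mul_single]

variable {Gt} in
theorem conjRingHom_conjRingHom_inv [G.Normal] (x : Gt) (r : MonoidAlgebra k ↥G) :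
    conjRingHom k Gt G x (conjRingHom k Gt G x⁻¹ r) = r := by
  induction r using MonoidAlgebra.induction_linear with
  | zero => simp
  | add r r' hr hr' => simp only [map_add, hr, hr']
  | single g a => simp [conjRingHom]

end GroupAlgebra

section Mackey

variable {k : Type u} [Field k] {Gt : Type u} [Group Gt] {G : Subgroup Gt} [G.Normal]
  {M : Type u} [AddCommGroup M] [Module (MonoidAlgebra k ↥G) M]
  {N : Type u} [AddCommGroup N] [Module (MonoidAlgebra k Gt) N]
  {j : M →+ N}

/-- The restriction to `kG` of the module induced from `M` decomposes along the cosets of `G`. -/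
theorem IsInducedMod.sum_cosets [Fintype (Gt ⧸ G)] (hN : IsInducedMod (inclRingHom k Gt G) M N j)
    {α : N →ₗ[MonoidAlgebra k Gt] coinduced (inclRingHom k Gt G) M}
    (hα : ∀ m s, (α (j m)).1 s = restrictCoeff k Gt G s • m) (n : N) :
    ∑ c : Gt ⧸ G, MonoidAlgebra.of k Gt c.out •
      j ((α n).1 (MonoidAlgebra.of k Gt c.out⁻¹)) = n := by
  let T (n : N) (x : Gt) : N := MonoidAlgebra.of k Gt x • j ((α n).1 (MonoidAlgebra.of k Gt x⁻¹))
  have hT (n : N) (x : Gt) (g : G) : T n (x * g) = T n x := by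
    have h1 : MonoidAlgebra.of k Gt (x * g)⁻¹ =
        inclRingHom k Gt G (MonoidAlgebra.single g⁻¹ 1) * MonoidAlgebra.of k Gt x⁻¹ := by
      simp [inclRingHom_single, MonoidAlgebra.single_mul_single]
    have h2 : MonoidAlgebra.of k Gt (x * g) * inclRingHom k Gt G (MonoidAlgebra.single g⁻¹ 1) =
        MonoidAlgebra.of k Gt x := by
      simp [inclRingHom_single, MonoidAlgebra.single_mul_single]
    simp only [T]
    rw [h1, (α n).2, hN.1, ← mul_smul, h2]
  have hout (n : N) (x : Gt) : T n (x : Gt ⧸ G).out = T n x := by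
    obtain ⟨g, hg⟩ := QuotientGroup.mk_out_eq_mul G x
    rw [hg, hT]
  have hmul (n : N) (y x : Gt) :
      T (MonoidAlgebra.of k Gt y • n) x = MonoidAlgebra.of k Gt y • T n (y⁻¹ * x) := by
    simp only [T]
    rw [map_smul, coinduced_smul_apply, ← mul_smul, ← map_mul, ← map_mul]
    simp
  have hsmul (n : N) (y : Gt) : ∑ c : Gt ⧸ G, T (MonoidAlgebra.of k Gt y • n) c.out =
      MonoidAlgebra.of k Gt y • ∑ c : Gt ⧸ G, T n c.out := by
    rw [Finset.smul_sum]
    refine Fintype.sum_equiv (MulAction.toPerm y⁻¹) _ _ fun c => ?_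
    rw [hmul]
    congr 1
    rw [← hout]
    congr 2
    conv_rhs => rw [← QuotientGroup.out_eq' c]
    rfl
  have hscalar (n : N) (a : k) (x : Gt) : T (MonoidAlgebra.single (1 : Gt) a • n) x =
      MonoidAlgebra.single (1 : Gt) a • T n x := by
    have h1 : MonoidAlgebra.of k Gt x⁻¹ * MonoidAlgebra.single (1 : Gt) a =
        inclRingHom k Gt G (MonoidAlgebra.single 1 a) * MonoidAlgebra.of k Gt x⁻¹ := by
      simp [inclRingHom_single, MonoidAlgebra.single_mul_single]
    have h2 : MonoidAlgebra.of k Gt x * inclRingHom k Gt G (MonoidAlgebra.single 1 a) =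
        MonoidAlgebra.single (1 : Gt) a * MonoidAlgebra.of k Gt x := by
      simp [inclRingHom_single, MonoidAlgebra.single_mul_single]
    simp only [T]
    rw [map_smul, coinduced_smul_apply, h1, (α n).2, hN.1, ← mul_smul, h2, mul_smul]
  have hadd (n n' : N) (x : Gt) : T (n + n') x = T n x + T n' x := by
    simp [T]
  let q : N →ₗ[MonoidAlgebra k Gt] N :=
    { toFun := fun n => ∑ c : Gt ⧸ G, T n c.out
      map_add' := fun n n' => by simp only [hadd, Finset.sum_add_distrib]
      map_smul' := fun s n => by
        induction s using MonoidAlgebra.induction_linear with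
        | zero => simp [T]
        | add s s' hs hs' =>
          simp only [RingHom.id_apply] at hs hs' ⊢
          simp only [add_smul, hadd, Finset.sum_add_distrib, hs, hs']
        | single y a =>
          have : MonoidAlgebra.single y a =
              MonoidAlgebra.single (1 : Gt) a * MonoidAlgebra.of k Gt y := by
            simp [MonoidAlgebra.single_mul_single]
          simp only [RingHom.id_apply, this, mul_smul, hscalar, ← Finset.smul_sum, hsmul] }
  have hq (m : M) : q (j m) = j m := by
    change ∑ c : Gt ⧸ G, T (j m) c.out = j m
    rw [Finset.sum_eq_single ((1 : Gt) : Gt ⧸ G)]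
    · rw [hout]
      simp only [T]
      rw [hα, inv_one, map_one, one_smul, MonoidAlgebra.one_def,
        restrictCoeff_single_mem k G 1 1 G.one_mem]
      exact congrArg j (one_smul _ m)
    · intro c _ hc
      simp only [T]
      have hout_mem : c.out⁻¹ ∉ G := by
        rw [G.inv_mem_iff]
        intro h
        apply hc
        rw [← QuotientGroup.out_eq' c]
        exact (QuotientGroup.eq_one_iff _).2 h
      have hzero : restrictCoeff k Gt G (MonoidAlgebra.of k Gt c.out⁻¹) = 0 :=
        restrictCoeff_single_notMem k G _ 1 hout_mem
      rw [hα, hzero, zero_smul, map_zero, smul_zero]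
    · simp
  obtain ⟨_, _, huniq⟩ := hN.2 N j hN.1
  exact LinearMap.congr_fun ((huniq q hq).trans (huniq LinearMap.id fun _ => rfl).symm) n

/-- The restriction to `kG` of the module induced from a `G̃`-stable module `M` is in `add M`. -/
theorem IsInducedMod.inAdd_restrict [Finite Gt] [Module (MonoidAlgebra k ↥G) N]
    (hres : ∀ (r : MonoidAlgebra k ↥G) (n : N), r • n = inclRingHom k Gt G r • n)
    (hM : ∀ x : Gt, IsConjStable k Gt G x M) (hN : IsInducedMod (inclRingHom k Gt G) M N j) :
    InAdd (MonoidAlgebra k ↥G) M N := by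
  classical
  have : Fintype (Gt ⧸ G) := Fintype.ofFinite _
  obtain ⟨α, hα⟩ := hN.exists_toCoinduced (restrictCoeff k Gt G)
    (restrictCoeff_incl_mul k Gt G) (restrictCoeff_mul_incl k Gt G)
  choose φ hφ using fun x : Gt => hM x⁻¹
  let i : N →ₗ[MonoidAlgebra k ↥G] (Gt ⧸ G → M) :=
    { toFun := fun n c => φ c.out ((α n).1 (MonoidAlgebra.of k Gt c.out⁻¹))
      map_add' := fun n n' => by ext; simp
      map_smul' := fun r n => by
        ext c
        rw [hres, map_smul, coinduced_smul_apply, of_mul_inclRingHom, (α n).2, hφ]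
        rfl }
  let p : (Gt ⧸ G → M) →ₗ[MonoidAlgebra k ↥G] N :=
    { toFun := fun v => ∑ c : Gt ⧸ G, MonoidAlgebra.of k Gt c.out • j ((φ c.out).symm (v c))
      map_add' := fun v v' => by simp [Finset.sum_add_distrib]
      map_smul' := fun r v => by
        rw [RingHom.id_apply, hres, Finset.smul_sum]
        refine Finset.sum_congr rfl fun c _ => ?_
        have h : (φ c.out).symm (r • v c) =
            conjRingHom k Gt G c.out⁻¹ r • (φ c.out).symm (v c) := by
          rw [AddEquiv.symm_apply_eq, hφ, AddEquiv.apply_symm_apply]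
        rw [Pi.smul_apply, h, hN.1, ← mul_smul, of_mul_inclRingHom,
          conjRingHom_conjRingHom_inv, mul_smul] }
  refine InAdd.of_fintype i p (LinearMap.ext fun n => ?_)
  change ∑ c : Gt ⧸ G, MonoidAlgebra.of k Gt c.out • j ((φ c.out).symm (φ c.out _)) = n
  simp only [AddEquiv.symm_apply_apply]
  exact hN.sum_cosets hα n

end Mackey

/-- If `x M ≅ M` for all `x ∈ G̃` and `f : kG → M'` is a left
`add M`-approximation of `kG` with `M' ∈ add M`, then the induced map
`Ind f : kG̃ → Ind M'` (the unique `kG̃`-linear map extending `j_{M'} ∘ f`)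
is a left `add (Ind M)`-approximation of `kG̃`. -/
theorem induced_left_approximation
    (k : Type u) [Field k] [IsAlgClosed k] (p : ℕ) (hp : 0 < p) [CharP k p]
    (Gt : Type u) [Group Gt] [Fintype Gt] (G : Subgroup Gt) [G.Normal]
    (M : Type u) [AddCommGroup M] [Module (MonoidAlgebra k ↥G) M]
    [Module.Finite (MonoidAlgebra k ↥G) M]
    (hM : ∀ x : Gt, IsConjStable k Gt G x M)
    (M' : Type u) [AddCommGroup M'] [Module (MonoidAlgebra k ↥G) M']
    (hM' : InAdd (MonoidAlgebra k ↥G) M M')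
    (f : MonoidAlgebra k ↥G →ₗ[MonoidAlgebra k ↥G] M')
    (happrox : ∀ (X : Type u) [AddCommGroup X] [Module (MonoidAlgebra k ↥G) X],
      InAdd (MonoidAlgebra k ↥G) M X →
      ∀ g : MonoidAlgebra k ↥G →ₗ[MonoidAlgebra k ↥G] X,
        ∃ h : M' →ₗ[MonoidAlgebra k ↥G] X, h.comp f = g)
    -- the induced modules of M and M'
    (N : Type u) [AddCommGroup N] [Module (MonoidAlgebra k Gt) N]
    (jM : M →+ N) (hN : IsInducedMod (inclRingHom k Gt G) M N jM)
    (N' : Type u) [AddCommGroup N'] [Module (MonoidAlgebra k Gt) N']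
    (jM' : M' →+ N') (hN' : IsInducedMod (inclRingHom k Gt G) M' N' jM')
    -- the induced map Ind f : kG̃ ≅ Ind kG → Ind M'
    (ftil : MonoidAlgebra k Gt →ₗ[MonoidAlgebra k Gt] N')
    (hftil : ∀ r : MonoidAlgebra k ↥G, ftil (inclRingHom k Gt G r) = jM' (f r)) :
    ∀ (X : Type u) [AddCommGroup X] [Module (MonoidAlgebra k Gt) X],
      InAdd (MonoidAlgebra k Gt) N X →
      ∀ g : MonoidAlgebra k Gt →ₗ[MonoidAlgebra k Gt] X,
        ∃ h : N' →ₗ[MonoidAlgebra k Gt] X, h.comp ftil = g := by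
  intro X _ _ hX g
  let _ : Module (MonoidAlgebra k ↥G) N := Module.compHom N (inclRingHom k Gt G)
  let _ : Module (MonoidAlgebra k ↥G) X := Module.compHom X (inclRingHom k Gt G)
  have hresX : InAdd (MonoidAlgebra k ↥G) M X :=
    (hN.inAdd_restrict (fun _ _ => rfl) hM).trans
      (hX.restrictScalars (inclRingHom k Gt G) (fun _ _ => rfl) fun _ _ => rfl)
  obtain ⟨h₀, hh₀⟩ := happrox X hresX (LinearMap.toSpanSingleton _ X (g 1))
  obtain ⟨h, hh, -⟩ := hN'.2 X h₀.toAddMonoidHom fun r m => h₀.map_smul r m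
  refine ⟨h, LinearMap.ext_ring ?_⟩
  have h1 := hftil 1
  rw [map_one] at h1
  rw [LinearMap.comp_apply, h1, hh]
  refine (LinearMap.congr_fun hh₀ 1).trans ?_
  rw [LinearMap.toSpanSingleton_apply, one_smul]
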